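/- Let F be any cumulative distribution function on ℝ and p ∈ (0,1). Then for every n ∈ ℕ and every q ∈ (p,1], n·μ_{p,q} − (F^{-1}(q) − F^{-1}(p)) ≤ sup_{S∈𝔖_n} VaR_p(S) ≤ n·μ_{p,1}. -/

import Mathlib

open MeasureTheory ProbabilityTheory Set Filter Topology Asymptotics

noncomputable section

/-- Generalized inverse `F⁻¹` of the CDF of the distribution `ν`:
`F⁻¹(t) = inf {x | F(x) ≥ t}` for `t ≠ 0` and `F⁻¹(0) = inf {x | F(x) > 0}`. -/
def qf (ν : Measure ℝ) (t : ℝ) : ℝ :=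
  if t = 0 then sInf {x : ℝ | 0 < (ν (Iic x)).toReal}
  else sInf {x : ℝ | t ≤ (ν (Iic x)).toReal}

/-- Extended-real-valued generalized inverse of the CDF of `ν` (so that
`F⁻¹(1) = +∞` for unbounded upper support and `F⁻¹(0) = −∞` for unbounded
lower support). -/
def qfE (ν : Measure ℝ) (t : ℝ) : EReal :=
  if t = 0 then sInf ((fun x : ℝ => (x : EReal)) '' {x : ℝ | 0 < (ν (Iic x)).toReal})
  else sInf ((fun x : ℝ => (x : EReal)) '' {x : ℝ | t ≤ (ν (Iic x)).toReal})

/-- `μ_{p,q} = (q−p)⁻¹ ∫_p^q F⁻¹(t) dt` as an extended real number. -/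
def muPQ (ν : Measure ℝ) (p q : ℝ) : EReal :=
  (((q - p)⁻¹ : ℝ) : EReal) * ((∫⁻ t in Ioo p q, ENNReal.ofReal (qf ν t) : ENNReal) : EReal)
    - (((q - p)⁻¹ : ℝ) : EReal) * ((∫⁻ t in Ioo p q, ENNReal.ofReal (-(qf ν t)) : ENNReal) : EReal)

/-- `μ_{p,q} = (q−p)⁻¹ ∫_p^q F⁻¹(t) dt` as a real number (when it is finite). -/
def muR (ν : Measure ℝ) (p q : ℝ) : ℝ := (q - p)⁻¹ * ∫ t in Ioo p q, qf ν t

/-- Value-at-Risk of a random variable `X` at level `p`: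
`VaR_p(X) = inf {x | P(X ≤ x) ≥ p}`. -/
def VaR {Ω : Type*} [MeasurableSpace Ω] (P : Measure Ω) (X : Ω → ℝ) (p : ℝ) : ℝ :=
  sInf {x : ℝ | p ≤ (P {ω | X ω ≤ x}).toReal}

/-- Expected Shortfall / Tail-Value-at-Risk at level `p`:
`TVaR_p(X) = (1−p)⁻¹ ∫_p^1 VaR_α(X) dα` (real-valued). -/
def TVaR {Ω : Type*} [MeasurableSpace Ω] (P : Measure Ω) (X : Ω → ℝ) (p : ℝ) : ℝ :=
  (1 - p)⁻¹ * ∫ α in p..(1:ℝ), VaR P X α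

/-- Extended-real-valued Tail-Value-at-Risk at level `p`, allowing the value `+∞`. -/
def TVaRE {Ω : Type*} [MeasurableSpace Ω] (P : Measure Ω) (X : Ω → ℝ) (p : ℝ) : EReal :=
  (((1 - p)⁻¹ : ℝ) : EReal) * ((∫⁻ α in Ioo p 1, ENNReal.ofReal (VaR P X α) : ENNReal) : EReal)
    - (((1 - p)⁻¹ : ℝ) : EReal) * ((∫⁻ α in Ioo p 1, ENNReal.ofReal (-(VaR P X α)) : ENNReal) : EReal)

/-- The set of values `VaR_p(S)` for `S` in the admissible risk class
`𝔖_n(F,…,F) = {X₁ + ⋯ + X_n : X_i ∼ F}` (over all atomless probability spaces). -/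
def VaRvals (ν : Measure ℝ) (n : ℕ) (p : ℝ) : Set ℝ :=
  {r | ∃ (Ω : Type) (mΩ : MeasurableSpace Ω) (P : Measure Ω) (X : Fin n → Ω → ℝ),
    IsProbabilityMeasure P ∧ (∀ i, Measure.map (X i) P = ν) ∧
    r = VaR P (fun ω => ∑ i, X i ω) p}

/-- The set of values `TVaR_p(S)` for `S` in the admissible risk class
`𝔖_n(F,…,F) = {X₁ + ⋯ + X_n : X_i ∼ F}` (over all atomless probability spaces). -/
def TVaRvals (ν : Measure ℝ) (n : ℕ) (p : ℝ) : Set ℝ :=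
  {r | ∃ (Ω : Type) (mΩ : MeasurableSpace Ω) (P : Measure Ω) (X : Fin n → Ω → ℝ),
    IsProbabilityMeasure P ∧ (∀ i, Measure.map (X i) P = ν) ∧
    r = TVaR P (fun ω => ∑ i, X i ω) p}

end

theorem exists_le_cdf (ν : Measure ℝ) {u : ℝ} (hu : u < 1) : ∃ x, u ≤ cdf ν x :=
  (((tendsto_cdf_atTop ν).eventually (lt_mem_nhds hu)).exists).imp fun _ h => h.le

theorem bddBelow_le_cdf (ν : Measure ℝ) {u : ℝ} (hu : 0 < u) : BddBelow {x | u ≤ cdf ν x} := by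
  obtain ⟨b, hb⟩ := ((tendsto_cdf_atBot ν).eventually (gt_mem_nhds hu)).exists
  refine ⟨b, fun x hx => ?_⟩
  by_contra! h
  exact absurd (hx.trans (monotone_cdf ν h.le)) (not_le.2 hb)

section Quantile

variable (ν : Measure ℝ) [IsProbabilityMeasure ν]

theorem qf_eq_sInf_cdf {u : ℝ} (hu : 0 < u) : qf ν u = sInf {x | u ≤ cdf ν x} := by
  simp only [qf, if_neg hu.ne', cdf_eq_real, measureReal_def]

/-- Galois connection between the quantile function and the distribution function. -/
theorem qf_le_iff {u : ℝ} (hu : 0 < u) (hne : ∃ x, u ≤ cdf ν x) {x : ℝ} :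
    qf ν u ≤ x ↔ u ≤ cdf ν x := by
  have hb := bddBelow_le_cdf ν hu
  rw [qf_eq_sInf_cdf ν hu]
  refine ⟨fun h => ?_, fun h => csInf_le hb h⟩
  refine le_trans ?_ (monotone_cdf ν h)
  have hc : Tendsto (cdf ν) (𝓝[>] (sInf {x | u ≤ cdf ν x}))
      (𝓝 (cdf ν (sInf {x | u ≤ cdf ν x}))) :=
    ((cdf ν).right_continuous _).tendsto.mono_left (nhdsWithin_mono _ Ioi_subset_Ici_self)
  refine ge_of_tendsto hc ?_
  filter_upwards [self_mem_nhdsWithin] with y hy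
  obtain ⟨z, hz, hzy⟩ := exists_lt_of_csInf_lt hne hy
  exact le_trans hz (monotone_cdf ν hzy.le)

theorem qf_mono {u v : ℝ} (hu : 0 < u) (huv : u ≤ v) (hne : ∃ x, v ≤ cdf ν x) :
    qf ν u ≤ qf ν v := by
  obtain ⟨x, hx⟩ := hne
  exact (qf_le_iff ν hu ⟨x, huv.trans hx⟩).2
    (huv.trans ((qf_le_iff ν (hu.trans_le huv) ⟨x, hx⟩).1 le_rfl))

theorem monotoneOn_qf : MonotoneOn (qf ν) (Ioo 0 1) := fun _ hu _ hv huv =>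
  qf_mono ν hu.1 huv (exists_le_cdf ν hv.2)

theorem aemeasurable_qf : AEMeasurable (qf ν) (volume.restrict (Ioo 0 1)) :=
  aemeasurable_restrict_of_monotoneOn measurableSet_Ioo (monotoneOn_qf ν)

/-- The quantile function transports the uniform distribution on `(0, 1)` to `ν`. -/
theorem map_qf : (volume.restrict (Ioo (0:ℝ) 1)).map (qf ν) = ν := by
  have : IsProbabilityMeasure (volume.restrict (Ioo (0:ℝ) 1)) := ⟨by simp⟩
  have := Measure.isProbabilityMeasure_map (aemeasurable_qf ν)
  refine Measure.ext_of_Iic _ _ fun x => ?_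
  rw [Measure.map_apply_of_aemeasurable (aemeasurable_qf ν) measurableSet_Iic,
    Measure.restrict_apply' measurableSet_Ioo, ← ofReal_cdf]
  have h : qf ν ⁻¹' Iic x ∩ Ioo 0 1 = Iic (cdf ν x) ∩ Ioo 0 1 := by
    ext u
    simp only [mem_inter_iff, mem_preimage, mem_Iic, and_congr_left_iff]
    exact fun hu => qf_le_iff ν hu.1 (exists_le_cdf ν hu.2)
  rw [h, ← Measure.restrict_apply' measurableSet_Ioo,
    Measure.restrict_congr_set Ioo_ae_eq_Ioc, Measure.restrict_apply measurableSet_Iic,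
    inter_comm, Ioc_inter_Iic, Real.volume_Ioc, inf_eq_right.2 (cdf_le_one ν x), sub_zero]

theorem qf_mem_Icc {a b : ℝ} (h : ∀ᵐ x ∂ν, x ∈ Icc a b) {u : ℝ} (hu : u ∈ Ioo (0:ℝ) 1) :
    qf ν u ∈ Icc a b := by
  have hne := exists_le_cdf ν hu.2
  constructor
  · by_contra! hlt
    have h1 : 0 < cdf ν (qf ν u) := hu.1.trans_le ((qf_le_iff ν hu.1 hne).1 le_rfl)
    have h2 : ν (Iic (qf ν u)) = 0 := by
      refine measure_mono_null (fun x (hx : x ≤ _) => ?_) h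
      exact fun hx' : x ∈ Icc a b => absurd (hx'.1.trans hx) (not_le.2 hlt)
    rw [← ofReal_cdf, ENNReal.ofReal_eq_zero] at h2
    linarith
  · rw [qf_le_iff ν hu.1 hne, cdf_eq_real]
    have : ν.real (Iic b) = 1 := by
      rw [measureReal_def, (prob_compl_eq_zero_iff measurableSet_Iic).1, ENNReal.toReal_one]
      refine measure_mono_null (fun x hx => ?_) h
      exact fun hx' : x ∈ Icc a b => hx hx'.2
    linarith [hu.2]

end Quantile

/-- Gluing: a variable `S` on `(Ω, P)` can be extended to a pair with prescribed joint law, provided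
the first marginal agrees with the law of `S`. -/
theorem exists_map_pair_eq {Ω : Type*} [MeasurableSpace Ω] (P : Measure Ω) [IsProbabilityMeasure P]
    {S : Ω → ℝ} (hS : Measurable S) (γ : Measure (ℝ × ℝ)) [IsProbabilityMeasure γ]
    (h : γ.map Prod.fst = P.map S) :
    ∃ R : Measure (Ω × ℝ), IsProbabilityMeasure R ∧ R.map Prod.fst = P ∧
      R.map (fun z => (S z.1, z.2)) = γ := by
  refine ⟨P ⊗ₘ (γ.condKernel.comap S hS), inferInstance, Measure.fst_compProd _ _, ?_⟩
  conv_rhs => rw [← γ.disintegrate γ.condKernel]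
  rw [Measure.fst, h]
  have hm : Measurable fun z : Ω × ℝ => (S z.1, z.2) := by fun_prop
  have : IsProbabilityMeasure (P.map S) := Measure.isProbabilityMeasure_map hS.aemeasurable
  ext s hs
  rw [Measure.map_apply hm hs, Measure.compProd_apply (hm hs), Measure.compProd_apply hs,
    lintegral_map (Kernel.measurable_kernel_prodMk_left hs) hS]
  rfl

/-- Countermonotone step: to a variable with oscillation at most `L = b - a` one can add a variable
with law `ρ` supported in `[a, b]` while keeping the oscillation at most `L`. -/
theorem exists_countermonotone (σ ρ : Measure ℝ) [IsProbabilityMeasure σ] [IsProbabilityMeasure ρ]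
    {a b c : ℝ} (hσ : ∀ᵐ x ∂σ, x ∈ Icc c (c + (b - a))) (hρ : ∀ᵐ x ∂ρ, x ∈ Icc a b) :
    ∃ γ : Measure (ℝ × ℝ), IsProbabilityMeasure γ ∧ γ.map Prod.fst = σ ∧ γ.map Prod.snd = ρ ∧
      ∃ c', ∀ᵐ z ∂γ, z.1 + z.2 ∈ Icc c' (c' + (b - a)) := by
  have hprob : IsProbabilityMeasure (volume.restrict (Ioo (0:ℝ) 1)) := ⟨by simp⟩
  have hflip : MeasurePreserving (fun u : ℝ => 1 - u) (volume.restrict (Ioo 0 1))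
      (volume.restrict (Ioo 0 1)) := by
    have := (Measure.measurePreserving_sub_left volume (1:ℝ)).restrict_preimage
      (measurableSet_Ioo (a := (0:ℝ)) (b := 1))
    simpa using this
  have hm2 : AEMeasurable (fun u => qf ρ (1 - u)) (volume.restrict (Ioo 0 1)) :=
    (aemeasurable_qf ρ).comp_quasiMeasurePreserving hflip.quasiMeasurePreserving
  have hm : AEMeasurable (fun u => (qf σ u, qf ρ (1 - u))) (volume.restrict (Ioo 0 1)) :=
    (aemeasurable_qf σ).prodMk hm2
  refine ⟨(volume.restrict (Ioo 0 1)).map (fun u => (qf σ u, qf ρ (1 - u))),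
    Measure.isProbabilityMeasure_map hm, ?_, ?_, ?_⟩
  · rw [AEMeasurable.map_map_of_aemeasurable measurable_fst.aemeasurable hm]
    exact map_qf σ
  · rw [AEMeasurable.map_map_of_aemeasurable measurable_snd.aemeasurable hm]
    have : (Prod.snd ∘ fun u => (qf σ u, qf ρ (1 - u))) = qf ρ ∘ fun u => 1 - u := rfl
    rw [this, ← AEMeasurable.map_map_of_aemeasurable _ hflip.aemeasurable, hflip.map_eq, map_qf]
    rw [hflip.map_eq]
    exact aemeasurable_qf ρ
  · have hflip' : ∀ u ∈ Ioo (0:ℝ) 1, 1 - u ∈ Ioo (0:ℝ) 1 := fun u hu =>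
      ⟨by linarith [hu.2], by linarith [hu.1]⟩
    have hs : ∀ u ∈ Ioo (0:ℝ) 1, qf σ u ∈ Icc c (c + (b - a)) := fun u hu => qf_mem_Icc σ hσ hu
    have hr : ∀ u ∈ Ioo (0:ℝ) 1, qf ρ (1 - u) ∈ Icc a b := fun u hu =>
      qf_mem_Icc ρ hρ (hflip' u hu)
    set T : ℝ → ℝ := fun u => qf σ u + qf ρ (1 - u) with hT
    have hosc : ∀ u ∈ Ioo (0:ℝ) 1, ∀ v ∈ Ioo (0:ℝ) 1, T u - (b - a) ≤ T v := by
      intro u hu v hv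
      have := hs u hu
      have := hs v hv
      have := hr u hu
      have := hr v hv
      simp only [hT, mem_Icc] at *
      rcases le_total u v with h | h
      · have := monotoneOn_qf σ hu hv h
        linarith
      · have := monotoneOn_qf ρ (hflip' u hu) (hflip' v hv) (by linarith)
        linarith
    have hbdd : BddBelow (T '' Ioo 0 1) := by
      refine ⟨c + a, ?_⟩
      rintro _ ⟨u, hu, rfl⟩
      exact add_le_add (hs u hu).1 (hr u hu).1
    refine ⟨sInf (T '' Ioo 0 1), ?_⟩
    refine (ae_map_iff hm (measurableSet_Icc.preimage (by fun_prop))).2 ?_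
    refine (ae_restrict_iff' measurableSet_Ioo).2 (.of_forall fun u hu => ?_)
    refine ⟨csInf_le hbdd ⟨u, hu, rfl⟩, ?_⟩
    have : T u - (b - a) ≤ sInf (T '' Ioo 0 1) := by
      refine le_csInf ((nonempty_Ioo.2 one_pos).image T) ?_
      rintro _ ⟨v, hv, rfl⟩
      exact hosc u hu v hv
    change T u ≤ _
    linarith

/-- Any number of variables with common law supported in `[a, b]` can be coupled so that their sum
has oscillation at most `b - a`. -/
theorem exists_coupling_sum_mem_Icc (ρ : Measure ℝ) [IsProbabilityMeasure ρ] {a b : ℝ}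
    (hρ : ∀ᵐ x ∂ρ, x ∈ Icc a b) (n : ℕ) :
    ∃ (Ω : Type) (_ : MeasurableSpace Ω) (P : Measure Ω) (X : Fin n → Ω → ℝ),
      IsProbabilityMeasure P ∧ (∀ i, Measurable (X i)) ∧ (∀ i, P.map (X i) = ρ) ∧
      ∃ c, ∀ᵐ ω ∂P, ∑ i, X i ω ∈ Icc c (c + (b - a)) := by
  induction n with
  | zero =>
    obtain ⟨x, hx⟩ := hρ.exists
    refine ⟨Unit, inferInstance, Measure.dirac (), fun i => i.elim0, inferInstance,
      fun i => i.elim0, fun i => i.elim0, 0, .of_forall fun ω => ?_⟩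
    simpa using hx.1.trans hx.2
  | succ n ih =>
    obtain ⟨Ω, mΩ, P, X, hP, hX, hmap, c, hc⟩ := ih
    have hS : Measurable fun ω => ∑ i, X i ω := Finset.measurable_fun_sum _ fun i _ => hX i
    have hσ := Measure.isProbabilityMeasure_map (μ := P) hS.aemeasurable
    obtain ⟨γ, hγ, hγ1, hγ2, c', hc'⟩ := exists_countermonotone (P.map fun ω => ∑ i, X i ω) ρ
      ((ae_map_iff hS.aemeasurable measurableSet_Icc).2 hc) hρ
    obtain ⟨R, hR, hR1, hR2⟩ := exists_map_pair_eq P hS γ hγ1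
    have hm : Measurable fun z : Ω × ℝ => (∑ i, X i z.1, z.2) :=
      (hS.comp measurable_fst).prodMk measurable_snd
    refine ⟨Ω × ℝ, inferInstance, R, Fin.cons Prod.snd fun i z => X i z.1, hR, ?_, ?_, c', ?_⟩
    · refine Fin.cases measurable_snd fun i => ?_
      exact (hX i).comp measurable_fst
    · refine Fin.cases ?_ fun i => ?_
      · rw [← hγ2, ← hR2, Measure.map_map measurable_snd hm]
        rfl
      · rw [← hmap i, ← hR1, Measure.map_map (hX i) measurable_fst]
        rfl
    · rw [← hR2] at hc'
      filter_upwards [ae_of_ae_map hm.aemeasurable hc'] with z hz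
      rw [Fin.sum_univ_succ]
      simpa [add_comm] using hz

theorem VaR_eq_qf_map {Ω : Type*} [MeasurableSpace Ω] (P : Measure Ω) {S : Ω → ℝ}
    (hS : AEMeasurable S P) {p : ℝ} (hp : p ≠ 0) : VaR P S p = qf (P.map S) p := by
  simp only [VaR, qf, if_neg hp, Measure.map_apply_of_aemeasurable hS measurableSet_Iic]
  rfl

section Tail

variable (ν : Measure ℝ) [IsProbabilityMeasure ν]

theorem measure_Iio_qf_le {p : ℝ} (hp : p ∈ Ioo (0:ℝ) 1) :
    ν (Iio (qf ν p)) ≤ ENNReal.ofReal p := by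
  rw [← measure_cdf ν, StieltjesFunction.measure_Iio _ (tendsto_cdf_atBot ν), sub_zero,
    measure_cdf]
  refine ENNReal.ofReal_le_ofReal (le_of_tendsto ((monotone_cdf ν).tendsto_leftLim _) ?_)
  filter_upwards [self_mem_nhdsWithin] with y hy
  by_contra! h
  exact absurd ((qf_le_iff ν hp.1 (exists_le_cdf ν hp.2)).2 h.le) (not_le.2 hy)

theorem le_qf_of_measure_Iio_le {p p' B : ℝ} (hp : p ∈ Ioo (0:ℝ) 1) (hp' : p' < p)
    (h : ν (Iio B) ≤ ENNReal.ofReal p') : B ≤ qf ν p := by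
  by_contra! hB
  have h1 : p ≤ cdf ν (qf ν p) := (qf_le_iff ν hp.1 (exists_le_cdf ν hp.2)).1 le_rfl
  have h2 : ENNReal.ofReal (cdf ν (qf ν p)) ≤ ENNReal.ofReal p' := by
    rw [ofReal_cdf]
    exact (measure_mono (Iic_subset_Iio.2 hB)).trans h
  rw [ENNReal.ofReal_le_ofReal_iff'] at h2
  rcases h2 with h2 | h2 <;> linarith [hp.1]

theorem integrableOn_qf {p q : ℝ} (hp : 0 < p) (hne : ∃ x, q ≤ cdf ν x) :
    IntegrableOn (qf ν) (Icc p q) := by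
  refine MonotoneOn.integrableOn_isCompact isCompact_Icc fun u hu v hv huv => ?_
  obtain ⟨x, hx⟩ := hne
  exact qf_mono ν (hp.trans_le hu.1) huv ⟨x, hv.2.trans hx⟩

theorem ae_qf_mem_Icc {p q : ℝ} (hp : 0 < p) (hne : ∃ x, q ≤ cdf ν x) :
    ∀ᵐ u ∂(volume.restrict (Ioo p q)), qf ν u ∈ Icc (qf ν p) (qf ν q) := by
  refine (ae_restrict_iff' measurableSet_Ioo).2 (.of_forall fun u hu => ?_)
  obtain ⟨x, hx⟩ := hne
  exact ⟨qf_mono ν hp hu.1.le ⟨x, hu.2.le.trans hx⟩, qf_mono ν (hp.trans hu.1) hu.2.le ⟨x, hx⟩⟩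

end Tail

/-- The excess over the `p`-quantile has mean `∫ (F⁻¹(u) - F⁻¹(p)) du` over `(p, 1)`. -/
theorem integral_max_sub_qf (ν : Measure ℝ) [IsProbabilityMeasure ν] {p : ℝ}
    (hp : p ∈ Ioo (0:ℝ) 1) (hint : IntegrableOn (qf ν) (Ioo p 1)) :
    Integrable (fun x => max (x - qf ν p) 0) ν ∧
      ∫ x, max (x - qf ν p) 0 ∂ν = (∫ u in Ioo p 1, qf ν u) - (1 - p) * qf ν p := by
  have hae : (fun u => max (qf ν u - qf ν p) 0) =ᵐ[volume.restrict (Ioo 0 1)]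
      (Ioo p 1).indicator fun u => qf ν u - qf ν p := by
    refine (ae_restrict_iff' measurableSet_Ioo).2 (.of_forall fun u hu => ?_)
    by_cases h : p < u
    · have hmem : u ∈ Ioo p 1 := ⟨h, hu.2⟩
      simp only [indicator_of_mem hmem,
        max_eq_left (sub_nonneg.2 (monotoneOn_qf ν hp hu h.le))]
    · have hmem : u ∉ Ioo p 1 := fun h' => h h'.1
      simp only [indicator_of_notMem hmem,
        max_eq_right (sub_nonpos.2 (monotoneOn_qf ν hu hp (not_lt.1 h)))]
  have hsub : IntegrableOn (fun u => qf ν u - qf ν p) (Ioo p 1) :=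
    hint.sub (integrableOn_const (by simp))
  have hcont : Continuous fun x : ℝ => max (x - qf ν p) 0 := by fun_prop
  have hI : Integrable (fun u => max (qf ν u - qf ν p) 0) (volume.restrict (Ioo 0 1)) :=
    (integrable_congr hae).2
      ((integrable_indicator_iff measurableSet_Ioo).2 hsub.restrict)
  have hsubset : Ioo p 1 ∩ Ioo 0 1 = Ioo p 1 :=
    inter_eq_left.2 (Ioo_subset_Ioo_left hp.1.le)
  constructor
  · have hI' := (integrable_map_measure hcont.aestronglyMeasurable (aemeasurable_qf ν)).2 hI
    rwa [map_qf ν] at hI'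
  · calc ∫ x, max (x - qf ν p) 0 ∂ν
        = ∫ x, max (x - qf ν p) 0 ∂((volume.restrict (Ioo (0:ℝ) 1)).map (qf ν)) := by rw [map_qf]
      _ = ∫ u in Ioo (0:ℝ) 1, max (qf ν u - qf ν p) 0 :=
        integral_map (aemeasurable_qf ν) hcont.aestronglyMeasurable
      _ = ∫ u in Ioo p 1, (qf ν u - qf ν p) := by
        rw [integral_congr_ae hae, integral_indicator measurableSet_Ioo,
          Measure.restrict_restrict measurableSet_Ioo, hsubset]
      _ = _ := by
        rw [integral_sub hint (integrableOn_const (by simp))]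
        simp [hp.2.le]

theorem VaR_sum_le {Ω : Type*} [MeasurableSpace Ω] (P : Measure Ω) [IsProbabilityMeasure P]
    (ν : Measure ℝ) [IsProbabilityMeasure ν] {p : ℝ} (hp : p ∈ Ioo (0:ℝ) 1)
    (hint : IntegrableOn (qf ν) (Ioo p 1)) {n : ℕ} (X : Fin n → Ω → ℝ)
    (hX : ∀ i, P.map (X i) = ν) :
    VaR P (fun ω => ∑ i, X i ω) p ≤ n * muR ν p 1 := by
  have hXm : ∀ i, AEMeasurable (X i) P := fun i =>
    AEMeasurable.of_map_ne_zero (by rw [hX i]; exact IsProbabilityMeasure.ne_zero ν)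
  have hS : AEMeasurable (fun ω => ∑ i, X i ω) P := Finset.aemeasurable_fun_sum _ fun i _ => hXm i
  have hprob := Measure.isProbabilityMeasure_map hS
  rw [VaR_eq_qf_map P hS hp.1.ne']
  have htail := measure_Iio_qf_le (P.map fun ω => ∑ i, X i ω) hp
  set v := qf (P.map fun ω => ∑ i, X i ω) p
  rw [Measure.map_apply_of_aemeasurable hS measurableSet_Iio] at htail
  obtain ⟨hi, hval⟩ := integral_max_sub_qf ν hp hint
  set m := qf ν p
  have hIi : ∀ i, Integrable (fun ω => max (X i ω - m) 0) P := fun i => by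
    rw [← hX i] at hi
    exact hi.comp_aemeasurable (hXm i)
  have hIv : ∀ i, ∫ ω, max (X i ω - m) 0 ∂P = (∫ u in Ioo p 1, qf ν u) - (1 - p) * m := fun i => by
    rw [← hval, ← integral_map (f := fun x => max (x - m) 0) (hXm i), hX i]
    exact Continuous.aestronglyMeasurable (by fun_prop)
  have hmarkov := mul_meas_ge_le_integral_of_nonneg (μ := P)
    (f := fun ω => ∑ i, max (X i ω - m) 0)
    (.of_forall fun ω => Finset.sum_nonneg fun i _ => le_max_right _ _)
    (integrable_finsetSum _ fun i _ => hIi i) (v - n * m)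
  rw [integral_finsetSum _ fun i _ => hIi i] at hmarkov
  simp only [hIv, Finset.sum_const, Finset.card_univ, Fintype.card_fin, nsmul_eq_mul] at hmarkov
  have hnn : 0 ≤ (∫ u in Ioo p 1, qf ν u) - (1 - p) * m := by
    rw [← hval]
    exact integral_nonneg fun x => le_max_right _ _
  have hp1 : 0 < 1 - p := sub_pos.2 hp.2
  have hge : 1 - p ≤ P.real {ω | v - n * m ≤ ∑ i, max (X i ω - m) 0} := by
    have h1 : P.real {ω | v - n * m ≤ ∑ i, max (X i ω - m) 0}ᶜ ≤ p := by
      refine ENNReal.toReal_le_of_le_ofReal hp.1.le ((measure_mono fun ω hω => ?_).trans htail)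
      by_contra h
      refine hω ?_
      have h2 : ∑ i, (X i ω - m) ≤ ∑ i, max (X i ω - m) 0 :=
        Finset.sum_le_sum fun i _ => le_max_left _ _
      simp only [Finset.sum_sub_distrib, Finset.sum_const, Finset.card_univ, Fintype.card_fin,
        nsmul_eq_mul] at h2
      simp only [mem_preimage, mem_Iio, not_lt] at h
      change v - n * m ≤ _
      linarith
    have h2 : (1:ℝ) ≤ P.real {ω | v - n * m ≤ ∑ i, max (X i ω - m) 0} +
        P.real {ω | v - n * m ≤ ∑ i, max (X i ω - m) 0}ᶜ := by
      refine le_trans ?_ (measureReal_union_le _ _)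
      rw [union_compl_self]
      simp
    linarith
  have hfinal : (1 - p) * (v - n * m) ≤ n * ((∫ u in Ioo p 1, qf ν u) - (1 - p) * m) := by
    rcases le_total (v - n * m) 0 with h | h
    · exact (mul_nonpos_of_nonneg_of_nonpos hp1.le h).trans (by positivity)
    · rw [mul_comm]
      exact (mul_le_mul_of_nonneg_left hge h).trans hmarkov
  have : (1 - p) * v ≤ n * ∫ u in Ioo p 1, qf ν u := by linarith
  rw [muR]
  calc v = (1 - p)⁻¹ * ((1 - p) * v) := by field_simp
    _ ≤ (1 - p)⁻¹ * (n * ∫ u in Ioo p 1, qf ν u) := by gcongr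
    _ = _ := by ring

theorem muPQ_eq_muR (ν : Measure ℝ) {p q : ℝ} (hint : IntegrableOn (qf ν) (Ioo p q)) :
    muPQ ν p q = muR ν p q := by
  have h1 : (∫⁻ t in Ioo p q, ENNReal.ofReal (qf ν t)) ≠ ⊤ := hint.lintegral_lt_top.ne
  have h2 : (∫⁻ t in Ioo p q, ENNReal.ofReal (-(qf ν t))) ≠ ⊤ := hint.neg.lintegral_lt_top.ne
  rw [muPQ, muR, integral_eq_lintegral_pos_part_sub_lintegral_neg_part hint,
    ← EReal.coe_ennreal_toReal h1, ← EReal.coe_ennreal_toReal h2, mul_sub]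
  push_cast
  rfl

theorem muPQ_eq_top (ν : Measure ℝ) [IsProbabilityMeasure ν] {p : ℝ}
    (hp : p ∈ Ioo (0:ℝ) 1) (hint : ¬ IntegrableOn (qf ν) (Ioo p 1)) : muPQ ν p 1 = ⊤ := by
  have hsub : Ioo p 1 ⊆ Ioo 0 1 := Ioo_subset_Ioo_left hp.1.le
  have hm : AEMeasurable (qf ν) (volume.restrict (Ioo p 1)) :=
    (aemeasurable_qf ν).mono_measure (Measure.restrict_mono hsub le_rfl)
  have h2 : (∫⁻ t in Ioo p 1, ENNReal.ofReal (-(qf ν t))) ≠ ⊤ := by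
    refine ne_top_of_le_ne_top (b := ∫⁻ t in Ioo p 1, ENNReal.ofReal (-(qf ν p))) ?_ ?_
    · simp [ENNReal.mul_eq_top]
    · refine setLIntegral_mono' measurableSet_Ioo fun u hu => ENNReal.ofReal_le_ofReal ?_
      exact neg_le_neg (monotoneOn_qf ν hp (hsub hu) hu.1.le)
  have h1 : (∫⁻ t in Ioo p 1, ENNReal.ofReal (qf ν t)) = ⊤ := by
    by_contra h1
    refine hint ⟨hm.aestronglyMeasurable, ?_⟩
    have : ∀ t, ‖qf ν t‖ₑ = ENNReal.ofReal (qf ν t) + ENNReal.ofReal (-(qf ν t)) := fun t => by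
      rw [Real.enorm_eq_ofReal_abs]
      rcases le_total 0 (qf ν t) with h | h
      · rw [abs_of_nonneg h, ENNReal.ofReal_of_nonpos (neg_nonpos.2 h), add_zero]
      · rw [abs_of_nonpos h, ENNReal.ofReal_of_nonpos h, zero_add]
    rw [HasFiniteIntegral]
    simp only [this]
    rw [lintegral_add_left' hm.ennreal_ofReal]
    exact ENNReal.add_lt_top.2 ⟨lt_top_iff_ne_top.2 h1, lt_top_iff_ne_top.2 h2⟩
  rw [muPQ, h1, ← EReal.coe_ennreal_toReal h2, ← EReal.coe_mul, EReal.coe_ennreal_top,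
    EReal.coe_mul_top_of_pos (inv_pos.2 (sub_pos.2 hp.2)), EReal.top_sub_coe]

/-- A coupling with `VaR` at level `p` at least `n μ_{p',q} - (F⁻¹(q) - F⁻¹(p'))` for `p' < p`. -/
theorem exists_mem_VaRvals_ge (ν : Measure ℝ) [IsProbabilityMeasure ν] {p p' q : ℝ}
    (hp : p ∈ Ioo (0:ℝ) 1) (hp'0 : 0 < p') (hp' : p' < p) (hpq : p < q) (hq1 : q ≤ 1)
    (hne : ∃ x, q ≤ cdf ν x) {n : ℕ} (hn : 0 < n) :
    ∃ r ∈ VaRvals ν n p, n * muR ν p' q - (qf ν q - qf ν p') ≤ r := by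
  have hlt : p' < q := hp'.trans hpq
  have hq0 : 0 < q := hp'0.trans hlt
  have hd : 0 < q - p' := sub_pos.2 hlt
  set κ : ENNReal := ENNReal.ofReal (q - p') with hκ
  have hκ0 : κ ≠ 0 := by simpa [hκ] using hlt
  have hκt : κ ≠ ⊤ := ENNReal.ofReal_ne_top
  have hsub : Ioo p' q ⊆ Ioo 0 1 := Ioo_subset_Ioo hp'0.le hq1
  have hmid : AEMeasurable (qf ν) (volume.restrict (Ioo p' q)) :=
    (aemeasurable_qf ν).mono_measure (Measure.restrict_mono hsub le_rfl)
  have hrest : AEMeasurable (qf ν) (volume.restrict (Ioo 0 1 \ Ioo p' q)) :=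
    (aemeasurable_qf ν).mono_measure (Measure.restrict_mono sdiff_subset le_rfl)
  set ρ : Measure ℝ := κ⁻¹ • (volume.restrict (Ioo p' q)).map (qf ν) with hρ
  have hρprob : IsProbabilityMeasure ρ := ⟨by
    rw [hρ, Measure.smul_apply, Measure.map_apply_of_aemeasurable hmid .univ]
    simp [← hκ, ENNReal.inv_mul_cancel hκ0 hκt]⟩
  have hρmem : ∀ᵐ x ∂ρ, x ∈ Icc (qf ν p') (qf ν q) :=
    Measure.ae_smul_measure ((ae_map_iff hmid measurableSet_Icc).2 (ae_qf_mem_Icc ν hp'0 hne)) _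
  have hρint : Integrable id ρ := by
    refine Integrable.of_mem_Icc _ _ aemeasurable_id hρmem
  have hρmean : ∫ x, x ∂ρ = muR ν p' q := by
    rw [hρ, integral_smul_measure, integral_map hmid (by fun_prop), muR, ENNReal.toReal_inv,
      ENNReal.toReal_ofReal hd.le, smul_eq_mul]
  have hmean_le : muR ν p' q ≤ qf ν q := by
    rw [← hρmean]
    calc ∫ x, x ∂ρ ≤ ∫ _, qf ν q ∂ρ :=
          integral_mono_ae hρint (integrable_const _) (hρmem.mono fun x hx => hx.2)
      _ = qf ν q := by simp
  obtain ⟨Ω, mΩ, P, X, hP, hX, hmap, c, hc⟩ := exists_coupling_sum_mem_Icc ρ hρmem n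
  set B := n * muR ν p' q - (qf ν q - qf ν p') with hB
  have hBc : B ≤ c := by
    have hXi : ∀ i, Integrable (X i) P := fun i => by
      have := hρint
      rw [← hmap i] at this
      exact this.comp_measurable (hX i)
    have hXv : ∀ i, ∫ ω, X i ω ∂P = muR ν p' q := fun i => by
      rw [← hρmean, ← hmap i, integral_map (hX i).aemeasurable (by fun_prop)]
    have h1 : ∫ ω, ∑ i, X i ω ∂P ≤ ∫ _, c + (qf ν q - qf ν p') ∂P :=
      integral_mono_ae (integrable_finsetSum _ fun i _ => hXi i) (integrable_const _)
        (hc.mono fun x hx => hx.2)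
    rw [integral_finsetSum _ fun i _ => hXi i] at h1
    simp only [hXv, Finset.sum_const, Finset.card_univ, Fintype.card_fin, nsmul_eq_mul,
      integral_const, probReal_univ, one_smul] at h1
    linarith
  have hBq : B ≤ n * qf ν q := by
    have h1 : qf ν p' ≤ qf ν q := qf_mono ν hp'0 hlt.le hne
    have h2 : n * muR ν p' q ≤ n * qf ν q := by gcongr
    linarith
  have hXX : Measurable fun ω i => X i ω := measurable_pi_lambda _ hX
  have hdiag : AEMeasurable (fun u (_ : Fin n) => qf ν u)
      (volume.restrict (Ioo 0 1 \ Ioo p' q)) := aemeasurable_pi_lambda _ fun _ => hrest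
  set Q : Measure (Fin n → ℝ) := κ • P.map (fun ω i => X i ω) +
    (volume.restrict (Ioo 0 1 \ Ioo p' q)).map (fun u _ => qf ν u) with hQ
  have hQmap : ∀ i, Q.map (fun x => x i) = ν := fun i => by
    have hi : Measurable fun x : Fin n → ℝ => x i := measurable_pi_apply i
    rw [hQ, Measure.map_add _ _ hi, Measure.map_smul, Measure.map_map hi hXX,
      AEMeasurable.map_map_of_aemeasurable hi.aemeasurable hdiag]
    change κ • P.map (X i) + (volume.restrict (Ioo 0 1 \ Ioo p' q)).map (qf ν) = ν
    rw [hmap i, hρ, smul_smul, ENNReal.mul_inv_cancel hκ0 hκt, one_smul,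
      ← AEMeasurable.map_add₀ hmid hrest,
      ← Measure.restrict_union disjoint_sdiff_right (measurableSet_Ioo.diff measurableSet_Ioo),
      union_sdiff_cancel hsub, map_qf]
  have hQprob : IsProbabilityMeasure Q := by
    have : IsProbabilityMeasure (Q.map (fun x => x ⟨0, hn⟩)) := by rw [hQmap]; infer_instance
    exact Measure.isProbabilityMeasure_of_map (fun x : Fin n → ℝ => x ⟨0, hn⟩)
  have hS : Measurable fun x : Fin n → ℝ => ∑ i, x i := by fun_prop
  have hSprob := Measure.isProbabilityMeasure_map (μ := Q) hS.aemeasurable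
  refine ⟨_, ⟨Fin n → ℝ, inferInstance, Q, fun i x => x i, hQprob, hQmap, rfl⟩, ?_⟩
  rw [VaR_eq_qf_map Q hS.aemeasurable hp.1.ne']
  refine le_qf_of_measure_Iio_le _ hp hp' ?_
  have hms : MeasurableSet ((fun x : Fin n → ℝ => ∑ i, x i) ⁻¹' Iio B) := hS measurableSet_Iio
  rw [Measure.map_apply hS measurableSet_Iio, hQ, Measure.add_apply, Measure.smul_apply,
    Measure.map_apply hXX hms, Measure.map_apply_of_aemeasurable hdiag hms,
    Measure.restrict_apply' (measurableSet_Ioo.diff measurableSet_Ioo)]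
  have h1 : P ((fun ω i => X i ω) ⁻¹' ((fun x : Fin n → ℝ => ∑ i, x i) ⁻¹' Iio B)) = 0 := by
    refine measure_mono_null (fun ω (hω : ∑ i, X i ω < B) => ?_) hc
    exact fun h : ∑ i, X i ω ∈ Icc _ _ => absurd (hω.trans_le (hBc.trans h.1)) (lt_irrefl _)
  rw [h1, smul_zero, zero_add]
  calc _ ≤ volume (Ioc 0 p') := measure_mono ?_
    _ = ENNReal.ofReal p' := by simp
  rintro u ⟨hu, hu01, humid⟩
  refine ⟨hu01.1, ?_⟩
  by_contra! h
  have hqu : q ≤ u := by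
    by_contra! h'
    exact humid ⟨h, h'⟩
  have h3 : qf ν q ≤ qf ν u := qf_mono ν hq0 hqu (exists_le_cdf ν hu01.2)
  have h4 : (n:ℝ) * qf ν u < B := by simpa using hu
  have h5 : (n:ℝ) * qf ν q ≤ n * qf ν u := by gcongr
  linarith

theorem tendsto_qf_left (ν : Measure ℝ) [IsProbabilityMeasure ν] {p : ℝ}
    (hp : p ∈ Ioo (0:ℝ) 1) : Tendsto (qf ν) (𝓝[<] p) (𝓝 (qf ν p)) := by
  have hmem : Ioo 0 p ∈ 𝓝[<] p := Ioo_mem_nhdsLT hp.1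
  refine tendsto_order.2 ⟨fun a ha => ?_, fun a ha => ?_⟩
  · have : cdf ν a < p := by
      by_contra! h
      exact absurd ((qf_le_iff ν hp.1 (exists_le_cdf ν hp.2)).2 h) (not_le.2 ha)
    filter_upwards [hmem, Ioo_mem_nhdsLT this] with u hu hu'
    by_contra! h
    exact absurd ((qf_le_iff ν hu.1 (exists_le_cdf ν (hu.2.trans hp.2))).1 h) (not_le.2 hu'.1)
  · filter_upwards [hmem] with u hu
    exact (monotoneOn_qf ν ⟨hu.1, hu.2.trans hp.2⟩ hp hu.2.le).trans_lt ha

theorem tendsto_muR_left (ν : Measure ℝ) [IsProbabilityMeasure ν] {p q : ℝ} (hp : 0 < p)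
    (hpq : p < q) (hne : ∃ x, q ≤ cdf ν x) :
    Tendsto (fun p' => muR ν p' q) (𝓝[<] p) (𝓝 (muR ν p q)) := by
  have hint : IntegrableOn (qf ν) (uIcc (p / 2) q) := by
    rw [uIcc_of_le (by linarith)]
    exact integrableOn_qf ν (half_pos hp) hne
  have hc := intervalIntegral.continuousOn_primitive_interval_left hint p
    (by rw [uIcc_of_le (by linarith)]; exact ⟨by linarith, hpq.le⟩)
  have hc' : Tendsto (fun x => ∫ t in x..q, qf ν t) (𝓝[<] p) (𝓝 (∫ t in p..q, qf ν t)) := by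
    refine hc.tendsto.mono_left (nhdsWithin_le_of_mem ?_)
    refine mem_of_superset (Ioo_mem_nhdsLT (half_lt_self hp)) fun u hu => ?_
    rw [uIcc_of_le (by linarith)]
    exact ⟨hu.1.le, (hu.2.trans hpq).le⟩
  have heq : ∀ u ≤ q, ∫ t in u..q, qf ν t = ∫ t in Ioo u q, qf ν t := fun u hu => by
    rw [intervalIntegral.integral_of_le hu, integral_Ioc_eq_integral_Ioo]
  rw [heq p hpq.le] at hc'
  have hi : Tendsto (fun x : ℝ => (q - x)⁻¹) (𝓝[<] p) (𝓝 (q - p)⁻¹) :=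
    ((tendsto_const_nhds.sub tendsto_id).inv₀ (sub_ne_zero.2 hpq.ne')).mono_left
      nhdsWithin_le_nhds
  refine (hi.mul hc').congr' ?_
  filter_upwards [self_mem_nhdsWithin] with u hu
  rw [muR, heq u (le_of_lt (lt_trans hu hpq))]

/-- **Theorem 3.2 (upper VaR bounds).** For any distribution `F`, `p ∈ (0,1)`, and any
`q ∈ (p,1]`,
`n μ_{p,q} − (F⁻¹(q) − F⁻¹(p)) ≤ sup_{S ∈ 𝔖_n} VaR_p(S) ≤ n μ_{p,1}`
(as extended real numbers). -/
theorem sup_VaR_bounds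
    (ν : Measure ℝ) [IsProbabilityMeasure ν] (p : ℝ) (hp : p ∈ Ioo (0:ℝ) 1)
    (n : ℕ) (hn : 0 < n) (q : ℝ) (hpq : p < q) (hq1 : q ≤ 1) :
    ((n : ℝ) : EReal) * muPQ ν p q - (qfE ν q - ((qf ν p : ℝ) : EReal)) ≤
      sSup ((fun r : ℝ => (r : EReal)) '' VaRvals ν n p) ∧
    sSup ((fun r : ℝ => (r : EReal)) '' VaRvals ν n p) ≤
      ((n : ℝ) : EReal) * muPQ ν p 1 := by
  constructor
  · by_cases hne : ∃ x, q ≤ cdf ν x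
    · have hq0 : 0 < q := hp.1.trans hpq
      have hqE : qfE ν q = (qf ν q : EReal) := by
        have hleast : IsLeast {x | q ≤ cdf ν x} (qf ν q) :=
          ⟨(qf_le_iff ν hq0 hne).1 le_rfl, fun x hx => (qf_le_iff ν hq0 hne).2 hx⟩
        have hset : {x : ℝ | q ≤ (ν (Iic x)).toReal} = {x | q ≤ cdf ν x} := by
          simp only [cdf_eq_real, measureReal_def]
        rw [qfE, if_neg hq0.ne', hset]
        exact (EReal.coe_strictMono.monotone.map_isLeast hleast).csInf_eq
      rw [hqE, muPQ_eq_muR ν ((integrableOn_qf ν hp.1 hne).mono_set Ioo_subset_Icc_self)]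
      have hlim : Tendsto (fun p' => n * muR ν p' q - (qf ν q - qf ν p')) (𝓝[<] p)
          (𝓝 (n * muR ν p q - (qf ν q - qf ν p))) :=
        ((tendsto_muR_left ν hp.1 hpq hne).const_mul _).sub
          (tendsto_const_nhds.sub (tendsto_qf_left ν hp))
      have hlim' := (continuous_coe_real_ereal.tendsto _).comp hlim
      have hgoal := le_of_tendsto hlim' (b := sSup ((fun r : ℝ => (r : EReal)) '' VaRvals ν n p)) <| by
        filter_upwards [Ioo_mem_nhdsLT hp.1] with p' hp'
        obtain ⟨r, hr, hle⟩ := exists_mem_VaRvals_ge ν hp hp'.1 hp'.2 hpq hq1 hne hn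
        exact (EReal.coe_le_coe_iff.2 hle).trans (le_sSup ⟨r, hr, rfl⟩)
      exact_mod_cast hgoal
    · have hset : {x : ℝ | q ≤ (ν (Iic x)).toReal} = ∅ := by
        refine eq_empty_of_forall_notMem fun x hx => hne ⟨x, ?_⟩
        rw [cdf_eq_real]
        exact hx
      have hqE : qfE ν q = ⊤ := by
        rw [qfE, if_neg (hp.1.trans hpq).ne', hset, image_empty, sInf_empty]
      rw [hqE, EReal.top_sub_coe, EReal.sub_top]
      exact bot_le
  · by_cases hint : IntegrableOn (qf ν) (Ioo p 1)
    · rw [muPQ_eq_muR ν hint]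
      refine sSup_le ?_
      rintro _ ⟨_, ⟨Ω, mΩ, P, X, hP, hX, rfl⟩, rfl⟩
      refine (EReal.coe_le_coe_iff.2 (VaR_sum_le P ν hp hint X hX)).trans_eq (by push_cast; rfl)
    · rw [muPQ_eq_top ν hp hint, EReal.coe_mul_top_of_pos (by exact_mod_cast hn)]
      exact le_top
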